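/- Let T be a densely defined closed EP operator on a complex Hilbert space H, and let λ be a nonzero complex number. Then the following are equivalent: (1) T − λI maps D(T) bijectively onto H and there exists C > 0 with ‖x‖ ≤ C‖Tx − λx‖ for all x ∈ D(T); (2) the restriction of T − λI to the carrier C(T) = D(T) ∩ (ker T)ᗮ maps C(T) bijectively onto (ker T)ᗮ and there exists C′ > 0 with ‖x‖ ≤ C′‖Tx − λx‖ for all x ∈ C(T). (In other words, λ ∈ ρ(T) if and only if λ ∈ ρ(T|_{C(T)}), viewing T|_{C(T)} as an operator from C(T) ⊆ (ker T)ᗮ into (ker T)ᗮ = R(T).) -/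

import Mathlib

open LinearPMap

variable {H : Type*} [NormedAddCommGroup H] [InnerProductSpace ℂ H] [CompleteSpace H]

/-- The range of a densely defined (partial) operator, as a submodule of `H`. -/
noncomputable def pmRange (T : H →ₗ.[ℂ] H) : Submodule ℂ H := LinearMap.range T.toFun

/-- The kernel of a densely defined (partial) operator, as a submodule of `H`. -/
noncomputable def pmKer (T : H →ₗ.[ℂ] H) : Submodule ℂ H :=
  (LinearMap.ker T.toFun).map T.domain.subtype

theorem mem_pmKer_iff {T : H →ₗ.[ℂ] H} {x : H} :
    x ∈ pmKer T ↔ ∃ y : T.domain, T y = 0 ∧ (y : H) = x := by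
  simp only [pmKer, Submodule.mem_map, LinearMap.mem_ker]
  rfl

theorem isClosed_pmKer {T : H →ₗ.[ℂ] H} (hT : IsClosed (T.graph : Set (H × H))) :
    IsClosed (pmKer T : Set H) := by
  have h : (pmKer T : Set H) = (fun x : H => (x, (0 : H))) ⁻¹' (T.graph : Set (H × H)) := by
    ext x
    simp only [SetLike.mem_coe, Set.mem_preimage, mem_pmKer_iff, LinearPMap.mem_graph_iff]
    exact exists_congr fun _ => and_comm
  rw [h]
  exact hT.preimage (by fun_prop)

theorem pmRange_adjoint_le_orthogonal_pmKer {T : H →ₗ.[ℂ] H}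
    (hT : Dense (T.domain : Set H)) : pmRange T.adjoint ≤ (pmKer T)ᗮ := by
  rintro _ ⟨w, rfl⟩
  rw [Submodule.mem_orthogonal']
  intro k hk
  obtain ⟨y, hy, rfl⟩ := mem_pmKer_iff.1 hk
  have h := LinearPMap.adjoint_isFormalAdjoint hT w y
  rw [hy, inner_zero_right] at h
  exact h

theorem norm_le_norm_add_of_inner_eq_zero {a b : H} (h : inner ℂ a b = 0) :
    ‖a‖ ≤ ‖a + b‖ := by
  have := norm_add_sq_eq_norm_sq_add_norm_sq_of_inner_eq_zero a b h
  nlinarith [norm_nonneg a, norm_nonneg b, norm_nonneg (a + b)]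

/-- Let `T` be a densely defined closed EP operator on a complex Hilbert space `H` and let
`λ ≠ 0`.  Then `λ ∈ ρ(T)` (that is, `T - λI : D(T) → H` is bijective with a bounded inverse)
if and only if `λ ∈ ρ(T|_{C(T)})`, where `T|_{C(T)}` is viewed as an operator from the carrier
`C(T) = D(T) ∩ (ker T)ᗮ` into `(ker T)ᗮ`. -/
theorem stmt5 (T : H →ₗ.[ℂ] H) (lam : ℂ) (hlam : lam ≠ 0)
    (hdense : Dense (T.domain : Set H))
    (hclosed : IsClosed (T.graph : Set (H × H)))
    (hEPclosed : IsClosed ((pmRange T : Submodule ℂ H) : Set H))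
    (hEP : pmRange T = pmRange T.adjoint) :
    -- (1) : `λ ∈ ρ(T)`
    ((Function.Injective fun x : T.domain => T x - lam • (x : H)) ∧
     (Function.Surjective fun x : T.domain => T x - lam • (x : H)) ∧
     (∃ C : ℝ, 0 < C ∧ ∀ x : T.domain, ‖(x : H)‖ ≤ C * ‖T x - lam • (x : H)‖))
    ↔
    -- (2) : `λ ∈ ρ(T|_{C(T)})`
    ((∀ x y : T.domain, (x : H) ∈ (pmKer T)ᗮ → (y : H) ∈ (pmKer T)ᗮ →
        T x - lam • (x : H) = T y - lam • (y : H) → x = y) ∧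
     (∀ x : T.domain, (x : H) ∈ (pmKer T)ᗮ → T x - lam • (x : H) ∈ (pmKer T)ᗮ) ∧
     (∀ z ∈ (pmKer T)ᗮ, ∃ x : T.domain, (x : H) ∈ (pmKer T)ᗮ ∧ T x - lam • (x : H) = z) ∧
     (∃ C : ℝ, 0 < C ∧ ∀ x : T.domain, (x : H) ∈ (pmKer T)ᗮ →
        ‖(x : H)‖ ≤ C * ‖T x - lam • (x : H)‖)) := by
  set K := pmKer T
  have hTK (x : T.domain) : T x ∈ Kᗮ :=
    pmRange_adjoint_le_orthogonal_pmKer hdense (hEP ▸ ⟨x, rfl⟩)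
  have hmaps (x : T.domain) (hx : (x : H) ∈ Kᗮ) : T x - lam • (x : H) ∈ Kᗮ :=
    Kᗮ.sub_mem (hTK x) (Kᗮ.smul_mem lam hx)
  have hcarrier (x : T.domain) (hx : T x - lam • (x : H) ∈ Kᗮ) : (x : H) ∈ Kᗮ := by
    have h := Kᗮ.sub_mem (hTK x) hx
    rw [sub_sub_cancel] at h
    exact (Kᗮ.smul_mem_iff hlam).1 h
  constructor
  · rintro ⟨hinj, hsurj, C, hC, hbound⟩
    refine ⟨fun x y _ _ h => hinj h, hmaps, fun z hz => ?_, C, hC, fun x _ => hbound x⟩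
    obtain ⟨x, rfl⟩ := hsurj z
    exact ⟨x, hcarrier x hz, rfl⟩
  · rintro ⟨-, -, hsurj, C, hC, hbound⟩
    have : CompleteSpace K := (isClosed_pmKer hclosed).completeSpace_coe
    have hbound' (x : T.domain) :
        ‖(x : H)‖ ≤ (‖lam‖⁻¹ + C) * ‖T x - lam • (x : H)‖ := by
      obtain ⟨k, hk, c, hc, hx⟩ := K.exists_add_mem_mem_orthogonal (x : H)
      obtain ⟨y, hy, rfl⟩ := mem_pmKer_iff.1 hk
      have hxy : ((x - y : T.domain) : H) = c := by
        rw [Submodule.coe_sub, hx, add_sub_cancel_left]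
      have hTxy : T (x - y) = T x := by rw [T.map_sub, hy, sub_zero]
      have hb := hbound (x - y) (hxy ▸ hc)
      have hm := hmaps (x - y) (hxy ▸ hc)
      rw [hxy, hTxy] at hb hm
      have hsplit : T x - lam • (x : H) = -(lam • (y : H)) + (T x - lam • c) := by
        rw [hx, smul_add]; abel
      have horth : inner ℂ (-(lam • (y : H))) (T x - lam • c) = 0 :=
        hm _ (K.neg_mem (K.smul_mem lam hk))
      have hky := norm_le_norm_add_of_inner_eq_zero horth
      have hcy := norm_le_norm_add_of_inner_eq_zero (inner_eq_zero_symm.1 horth)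
      rw [add_comm, ← hsplit] at hcy
      rw [← hsplit, norm_neg, norm_smul] at hky
      calc ‖(x : H)‖ ≤ ‖(y : H)‖ + ‖c‖ := hx ▸ norm_add_le _ _
        _ ≤ ‖lam‖⁻¹ * ‖T x - lam • (x : H)‖ + C * ‖T x - lam • (x : H)‖ := by
          gcongr
          · rwa [le_inv_mul_iff₀ (norm_pos_iff.2 hlam)]
          · exact hb.trans (by gcongr)
        _ = _ := (add_mul _ _ _).symm
    refine ⟨fun x y hxy => ?_, fun z => ?_, _, by positivity, hbound'⟩
    · have h := hbound' (x - y)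
      have h0 : T (x - y) - lam • ((x - y : T.domain) : H) = 0 := by
        rw [T.map_sub, Submodule.coe_sub, smul_sub, sub_sub_sub_comm]
        exact sub_eq_zero.2 hxy
      rw [h0, norm_zero, mul_zero, norm_le_zero_iff, Submodule.coe_sub, sub_eq_zero] at h
      exact Subtype.ext h
    · obtain ⟨k, hk, c, hc, rfl⟩ := K.exists_add_mem_mem_orthogonal z
      obtain ⟨y, hy, rfl⟩ := mem_pmKer_iff.1 hk
      obtain ⟨x, -, rfl⟩ := hsurj c hc
      refine ⟨x - lam⁻¹ • y, ?_⟩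
      simp only [T.map_sub, T.map_smul, hy, Submodule.coe_sub, Submodule.coe_smul, smul_sub,
        smul_inv_smul₀ hlam, smul_zero, sub_zero]
      abel
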